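/- arXiv:1908.09143 — 2 statements merged into one kernel-verified Lean document; each statement's English description precedes it below -/
import Mathlib

section
/- Let α ∈ (0,1), set c_α = α·2^(α−1)·Γ((1+α)/2)/(√π·Γ(1−α/2)), and define u : ℝ → ℂ by u(z) = (z²−1)/(z²+1) + i·2z/(z²+1) (equivalently, u(z) = (z+i)/(z−i)). Then for every x ∈ ℝ the function y ↦ (u(x)−u(x+y))/|y|^(1+α) is Lebesgue integrable on ℝ and c_α ∫_ℝ (u(x)−u(x+y))/|y|^(1+α) dy = −2·Γ(1+α)/(1+ix)^{1+α}, where (1+ix)^{1+α} denotes the principal branch of the complex power (well defined since 1+ix has positive real part). -/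
open MeasureTheory Filter Set Real

lemma integrableOn_rpow_mul_exp_neg_mul {q b : ℝ} (hq : -1 < q) (hb : 0 < b) :
    IntegrableOn (fun t : ℝ => t ^ q * rexp (-b * t)) (Ioi 0) := by
  simpa using integrableOn_rpow_mul_exp_neg_mul_rpow hq one_pos hb

lemma norm_ofReal_rpow_mul_cexp {q t : ℝ} (ht : 0 < t) (a : ℂ) :
    ‖((t ^ q : ℝ) : ℂ) * Complex.exp (-(a * t))‖ = t ^ q * rexp (-a.re * t) := by
  rw [norm_mul, Complex.norm_real, Complex.norm_exp, Real.norm_of_nonneg (by positivity)]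
  simp

lemma aestronglyMeasurable_rpow_mul_cexp (q : ℝ) (a : ℂ) :
    AEStronglyMeasurable (fun t : ℝ => ((t ^ q : ℝ) : ℂ) * Complex.exp (-(a * t)))
      (volume.restrict (Ioi 0)) := by
  apply Measurable.aestronglyMeasurable
  fun_prop

lemma integrableOn_rpow_mul_cexp {q : ℝ} (hq : -1 < q) {a : ℂ} (ha : 0 < a.re) :
    IntegrableOn (fun t : ℝ => ((t ^ q : ℝ) : ℂ) * Complex.exp (-(a * t))) (Ioi 0) := by
  refine (integrableOn_rpow_mul_exp_neg_mul hq ha).mono'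
    (aestronglyMeasurable_rpow_mul_cexp q a) ?_
  filter_upwards [self_mem_ae_restrict measurableSet_Ioi] with t ht
  exact (norm_ofReal_rpow_mul_cexp ht a).le

lemma differentiableAt_laplace_rpow {q : ℝ} (hq : -1 < q) {a : ℂ} (ha : 0 < a.re) :
    DifferentiableAt ℂ
      (fun z : ℂ => ∫ t in Ioi (0 : ℝ), ((t ^ q : ℝ) : ℂ) * Complex.exp (-(z * t))) a := by
  have hball : Metric.ball a (a.re / 2) ∈ nhds a := Metric.ball_mem_nhds _ (by positivity)
  refine (hasDerivAt_integral_of_dominated_loc_of_deriv_le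
    (F' := fun z t => ((t ^ q : ℝ) : ℂ) * (Complex.exp (-(z * t)) * (-t)))
    (bound := fun t : ℝ => t ^ (q + 1) * rexp (-(a.re / 2) * t)) hball
    (Eventually.of_forall fun z => aestronglyMeasurable_rpow_mul_cexp q z)
    (integrableOn_rpow_mul_cexp hq ha) ?_ ?_
    (integrableOn_rpow_mul_exp_neg_mul (by linarith) (by positivity)) ?_).2.differentiableAt
  · apply Measurable.aestronglyMeasurable
    fun_prop
  · filter_upwards [self_mem_ae_restrict measurableSet_Ioi] with t ht z hz
    have ht' : 0 < t := ht
    have hre : a.re / 2 ≤ z.re := by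
      have h1 := Complex.abs_re_le_norm (z - a)
      rw [Metric.mem_ball, dist_eq_norm] at hz
      rw [Complex.sub_re] at h1
      have := neg_abs_le (z.re - a.re)
      linarith
    rw [← mul_assoc, norm_mul, norm_ofReal_rpow_mul_cexp ht', norm_neg, Complex.norm_real,
      Real.norm_of_nonneg ht'.le, Real.rpow_add_one ht'.ne', mul_right_comm]
    gcongr
  · refine Eventually.of_forall fun t z _ => ?_
    refine HasDerivAt.const_mul _ (HasDerivAt.cexp ?_)
    exact (hasDerivAt_mul_const (t : ℂ)).neg

/-- The Laplace transform of `t ^ q` on the right half-plane. -/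
lemma integral_rpow_mul_cexp {q : ℝ} (hq : -1 < q) {a : ℂ} (ha : 0 < a.re) :
    ∫ t in Ioi (0 : ℝ), ((t ^ q : ℝ) : ℂ) * Complex.exp (-(a * t))
      = (Real.Gamma (q + 1) : ℂ) / a ^ ((q + 1 : ℝ) : ℂ) := by
  have hopen : IsOpen {z : ℂ | 0 < z.re} := isOpen_lt continuous_const Complex.continuous_re
  have hF : AnalyticOnNhd ℂ
      (fun z : ℂ => ∫ t in Ioi (0 : ℝ), ((t ^ q : ℝ) : ℂ) * Complex.exp (-(z * t)))
      {z : ℂ | 0 < z.re} :=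
    DifferentiableOn.analyticOnNhd
      (fun z hz => (differentiableAt_laplace_rpow hq hz).differentiableWithinAt) hopen
  have hG : AnalyticOnNhd ℂ
      (fun z : ℂ => (Real.Gamma (q + 1) : ℂ) / z ^ ((q + 1 : ℝ) : ℂ)) {z : ℂ | 0 < z.re} := by
    refine DifferentiableOn.analyticOnNhd (fun z hz => ?_) hopen
    have hz0 : z ≠ 0 := by rintro rfl; simp at hz
    refine ((differentiableAt_const _).div ?_ ?_).differentiableWithinAt
    · exact differentiableAt_id.cpow (differentiableAt_const _) (Or.inl hz)
    · simp [Complex.cpow_eq_zero_iff, hz0]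
  refine hF.eqOn_of_preconnected_of_frequently_eq hG
    (convex_halfSpace_re_gt 0).isPreconnected (z₀ := 1) (by simp) ?_ ha
  have hreal : ∀ r : ℝ, 0 < r →
      ∫ t in Ioi (0 : ℝ), ((t ^ q : ℝ) : ℂ) * Complex.exp (-((r : ℂ) * t))
        = (Real.Gamma (q + 1) : ℂ) / (r : ℂ) ^ ((q + 1 : ℝ) : ℂ) := by
    intro r hr
    have h := Real.integral_rpow_mul_exp_neg_mul_Ioi (a := q + 1) (by linarith) hr
    rw [add_sub_cancel_right] at h
    calc _ = ∫ t in Ioi (0 : ℝ), ((t ^ q * rexp (-(r * t)) : ℝ) : ℂ) := by push_cast; rfl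
      _ = _ := by
        rw [integral_complex_ofReal, h, ← Complex.ofReal_cpow hr.le, ← Complex.ofReal_div,
          Real.div_rpow one_pos.le hr.le, Real.one_rpow, one_div_mul_eq_div]
  have htend : Tendsto (fun r : ℝ => (r : ℂ)) (nhdsWithin 1 {1}ᶜ) (nhdsWithin 1 {1}ᶜ) := by
    refine tendsto_nhdsWithin_iff.2 ⟨?_, ?_⟩
    · exact (Complex.continuous_ofReal.tendsto' 1 1 (by simp)).mono_left nhdsWithin_le_nhds
    · filter_upwards [self_mem_nhdsWithin] with r hr
      simpa using hr
  refine htend.frequently (Eventually.frequently ?_)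
  filter_upwards [nhdsWithin_le_nhds (lt_mem_nhds (zero_lt_one' ℝ))] with r hr
  exact hreal r hr

lemma integrable_comp_abs {f : ℝ → ℝ} (hf : IntegrableOn f (Ioi 0)) :
    Integrable (fun y : ℝ => f |y|) := by
  have hf' : IntegrableOn (fun y : ℝ => f |y|) (Ioi 0) :=
    hf.congr_fun (fun y hy => by rw [abs_of_pos hy]) measurableSet_Ioi
  have h : IntegrableOn (fun y : ℝ => f |y|) (Iic 0) := by
    rw [integrableOn_Iic_iff_integrableOn_Iio]
    have h := IntegrableOn.comp_neg_Iio (c := (0 : ℝ)) (f := fun y : ℝ => f |y|)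
      (by rwa [neg_zero])
    simpa using h
  rw [← integrableOn_univ, ← Iic_union_Ioi (a := (0 : ℝ))]
  exact h.union hf'

lemma norm_one_sub_cexp_neg_le (y : ℝ) : ‖1 - Complex.exp (-(Complex.I * y))‖ ≤ min 2 |y| := by
  refine le_min ?_ ?_
  · refine (norm_sub_le _ _).trans ?_
    have := Complex.norm_exp_I_mul_ofReal (-y)
    push_cast at this
    rw [mul_neg] at this
    rw [this]
    norm_num
  · have := norm_exp_I_mul_ofReal_sub_one_le (x := -y)
    rw [norm_sub_rev]
    simpa using this

lemma integrableOn_min_div_rpow {α : ℝ} (h0 : 0 < α) (h1 : α < 1) :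
    IntegrableOn (fun y : ℝ => min 2 y / y ^ (1 + α)) (Ioi 0) := by
  have hm : Measurable (fun y : ℝ => min 2 y / y ^ (1 + α)) := by fun_prop
  rw [← Ioc_union_Ioi_eq_Ioi zero_le_one]
  refine IntegrableOn.union ?_ ?_
  · have h := (intervalIntegral.intervalIntegrable_rpow' (a := 0) (b := 1)
      (by linarith : -1 < -α)).1
    refine h.mono' hm.aestronglyMeasurable ?_
    filter_upwards [self_mem_ae_restrict measurableSet_Ioc] with y hy
    have hy0 : 0 < y := hy.1
    rw [Real.norm_of_nonneg (by positivity), div_le_iff₀ (by positivity), ← Real.rpow_add hy0]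
    simp
  · have h := (integrableOn_Ioi_rpow_of_lt (by linarith : -(1 + α) < -1) one_pos).const_mul 2
    refine h.mono' hm.aestronglyMeasurable ?_
    filter_upwards [self_mem_ae_restrict measurableSet_Ioi] with y hy
    have hy0 : 0 < y := one_pos.trans hy
    rw [Real.norm_of_nonneg (by positivity), Real.rpow_neg hy0.le, ← div_eq_mul_inv]
    gcongr
    exact min_le_left _ _

lemma integrable_one_sub_cexp_div {α : ℝ} (h0 : 0 < α) (h1 : α < 1) :
    Integrable (fun y : ℝ => (1 - Complex.exp (-(Complex.I * y))) / ((|y| ^ (1 + α) : ℝ) : ℂ)) := by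
  refine (integrable_comp_abs (integrableOn_min_div_rpow h0 h1)).mono' ?_ ?_
  · apply Measurable.aestronglyMeasurable
    fun_prop
  · refine Eventually.of_forall fun y => ?_
    rw [norm_div, Complex.norm_real, Real.norm_of_nonneg (by positivity)]
    gcongr
    exact norm_one_sub_cexp_neg_le y

lemma integral_rpow_div_one_add_sq {α : ℝ} (h0 : 0 < α) (h1 : α < 1) :
    ∫ y in Ioi (0 : ℝ), y ^ (1 - α) / (1 + y ^ 2)
      = Real.Gamma (α / 2) * Real.Gamma (1 - α / 2) / 2 := by
  have hinner : ∀ s : ℝ, 0 < s → ∫ y in Ioi (0 : ℝ), y ^ (1 - α) * rexp (-(1 + y ^ 2) * s)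
      = Real.Gamma (1 - α / 2) / 2 * (s ^ (α / 2 - 1) * rexp (-1 * s)) := by
    intro s hs
    have h := integral_rpow_mul_exp_neg_mul_rpow (p := 2) (q := 1 - α) (b := s) two_pos
      (by linarith) hs
    calc _ = ∫ y in Ioi (0 : ℝ), rexp (-s) * (y ^ (1 - α) * rexp (-s * y ^ (2 : ℝ))) := by
          congr 1 with y
          rw [mul_left_comm, ← Real.exp_add, Real.rpow_two]
          ring_nf
      _ = _ := by
        rw [integral_const_mul, h, show -(1 - α + 1) / 2 = α / 2 - 1 by ring,
          show (1 - α + 1) / 2 = 1 - α / 2 by ring, neg_one_mul]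
        ring
  have hint : Integrable (Function.uncurry
      fun s y : ℝ => y ^ (1 - α) * rexp (-(1 + y ^ 2) * s))
      ((volume.restrict (Ioi 0)).prod (volume.restrict (Ioi 0))) := by
    rw [integrable_prod_iff]
    · constructor
      · filter_upwards [self_mem_ae_restrict measurableSet_Ioi] with s hs
        have h := (integrableOn_rpow_mul_exp_neg_mul_sq (b := s) hs
          (by linarith : -1 < 1 - α)).const_mul (rexp (-s))
        refine h.congr (Eventually.of_forall fun y => ?_)
        simp only [Function.uncurry]
        rw [mul_left_comm, ← Real.exp_add]
        ring_nf
      · have h : IntegrableOn (fun s : ℝ => Real.Gamma (1 - α / 2) / 2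
            * (s ^ (α / 2 - 1) * rexp (-1 * s))) (Ioi 0) := by
          exact Integrable.const_mul
            (integrableOn_rpow_mul_exp_neg_mul (by linarith : -1 < α / 2 - 1) one_pos) _
        refine h.congr ?_
        filter_upwards [self_mem_ae_restrict measurableSet_Ioi] with s hs
        rw [← hinner s hs]
        refine setIntegral_congr_fun measurableSet_Ioi fun y hy => ?_
        have hy0 : 0 < y := hy
        exact (Real.norm_of_nonneg (by positivity)).symm
    · apply Measurable.aestronglyMeasurable
      simp only [Function.uncurry_def]
      fun_prop
  calc _ = ∫ y in Ioi (0 : ℝ), ∫ s in Ioi (0 : ℝ), y ^ (1 - α) * rexp (-(1 + y ^ 2) * s) := by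
        refine setIntegral_congr_fun measurableSet_Ioi fun y _ => ?_
        have hy : 0 < 1 + y ^ 2 := by positivity
        rw [integral_const_mul, integral_exp_mul_Ioi (neg_neg_of_pos hy)]
        simp [div_eq_mul_inv]
        grind
    _ = ∫ s in Ioi (0 : ℝ), Real.Gamma (1 - α / 2) / 2 * (s ^ (α / 2 - 1) * rexp (-1 * s)) := by
        rw [← integral_integral_swap hint]
        exact setIntegral_congr_fun measurableSet_Ioi fun s hs => hinner s hs
    _ = _ := by
        have h := Real.integral_rpow_mul_exp_neg_mul_Ioi (a := α / 2) (by positivity) one_pos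
        simp only [one_mul, div_one, Real.one_rpow] at h
        simp only [neg_one_mul]
        rw [integral_const_mul, h]
        ring

lemma cexp_sub_cexp_div_eq {α : ℝ} {t : ℝ} (ht : 0 < t) (y : ℝ) (a : ℂ) :
    (Complex.exp (-(a * t)) - Complex.exp (-((a + Complex.I * y) * t))) / ((|y| ^ (1 + α) : ℝ) : ℂ)
      = ((t ^ (1 + α) : ℝ) : ℂ) * Complex.exp (-(a * t))
        * ((1 - Complex.exp (-(Complex.I * (t * y : ℝ)))) / ((|t * y| ^ (1 + α) : ℝ) : ℂ)) := by
  have h1 : Complex.exp (-((a + Complex.I * y) * t))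
      = Complex.exp (-(a * t)) * Complex.exp (-(Complex.I * (t * y : ℝ))) := by
    rw [← Complex.exp_add]
    push_cast
    ring_nf
  have h2 : ((t ^ (1 + α) : ℝ) : ℂ) ≠ 0 := by
    exact_mod_cast (Real.rpow_pos_of_pos ht _).ne'
  rw [h1, abs_mul, abs_of_pos ht, Real.mul_rpow ht.le (abs_nonneg y), Complex.ofReal_mul (t ^ _),
    mul_right_comm, mul_div_assoc', mul_div_mul_left _ _ h2]
  ring

lemma integrable_laplace_kernel {α : ℝ} (h0 : 0 < α) (h1 : α < 1) {a : ℂ} (ha : 0 < a.re) :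
    Integrable (Function.uncurry fun t y : ℝ =>
      (Complex.exp (-(a * t)) - Complex.exp (-((a + Complex.I * y) * t)))
        / ((|y| ^ (1 + α) : ℝ) : ℂ)) ((volume.restrict (Ioi 0)).prod volume) := by
  have hg := integrable_one_sub_cexp_div h0 h1
  rw [integrable_prod_iff]
  · constructor
    · filter_upwards [self_mem_ae_restrict measurableSet_Ioi] with t ht
      have ht0 : 0 < t := ht
      simp only [Function.uncurry, cexp_sub_cexp_div_eq ht0]
      exact (hg.comp_mul_left' ht0.ne').const_mul _
    · have h := (integrableOn_rpow_mul_exp_neg_mul (by linarith : -1 < α) ha).mul_const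
        (∫ y : ℝ, ‖(1 - Complex.exp (-(Complex.I * y))) / ((|y| ^ (1 + α) : ℝ) : ℂ)‖)
      refine h.congr ?_
      filter_upwards [self_mem_ae_restrict measurableSet_Ioi] with t ht
      have ht0 : 0 < t := ht
      simp only [Function.uncurry, cexp_sub_cexp_div_eq ht0]
      simp only [norm_mul _ (_ / _ : ℂ), norm_ofReal_rpow_mul_cexp ht0]
      rw [integral_const_mul, Measure.integral_comp_mul_left
        (fun y : ℝ => ‖(1 - Complex.exp (-(Complex.I * y))) / ((|y| ^ (1 + α) : ℝ) : ℂ)‖),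
        abs_of_pos (inv_pos.2 ht0), smul_eq_mul, add_comm 1 α, Real.rpow_add_one ht0.ne']
      field_simp
  · apply Measurable.aestronglyMeasurable
    simp only [Function.uncurry_def]
    fun_prop

lemma integral_cexp_sub_cexp {a : ℂ} (ha : 0 < a.re) (y : ℝ) (c : ℂ) :
    ∫ t in Ioi (0 : ℝ), (Complex.exp (-(a * t)) - Complex.exp (-((a + Complex.I * y) * t))) / c
      = (1 / a - 1 / (a + Complex.I * y)) / c := by
  have hb : 0 < (a + Complex.I * y).re := by simpa using ha
  have hI : ∀ b : ℂ, 0 < b.re → IntegrableOn (fun t : ℝ => Complex.exp (-(b * t))) (Ioi 0) := by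
    intro b hb
    simpa using integrableOn_exp_mul_complex_Ioi (a := -b) (by simpa using hb) 0
  have hv : ∀ b : ℂ, 0 < b.re → ∫ t in Ioi (0 : ℝ), Complex.exp (-(b * t)) = 1 / b := by
    intro b hb
    simpa [neg_div_neg_eq] using integral_exp_mul_complex_Ioi (a := -b) (by simpa using hb) 0
  rw [integral_div, integral_sub (hI a ha) (hI _ hb), hv a ha, hv _ hb]

lemma integrable_inv_sub_inv_div {α : ℝ} (h0 : 0 < α) (h1 : α < 1) {a : ℂ} (ha : 0 < a.re) :
    Integrable (fun y : ℝ =>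
      (1 / a - 1 / (a + Complex.I * y)) / ((|y| ^ (1 + α) : ℝ) : ℂ)) := by
  have h := (integrable_laplace_kernel h0 h1 ha).integral_prod_right
  simpa only [Function.uncurry, integral_cexp_sub_cexp ha] using h

lemma integral_inv_sub_inv_div {α : ℝ} (h0 : 0 < α) (h1 : α < 1) {a : ℂ} (ha : 0 < a.re) :
    ∫ y : ℝ, (1 / a - 1 / (a + Complex.I * y)) / ((|y| ^ (1 + α) : ℝ) : ℂ)
      = (∫ y : ℝ, (1 - Complex.exp (-(Complex.I * y))) / ((|y| ^ (1 + α) : ℝ) : ℂ))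
        * (Real.Gamma (1 + α) : ℂ) / a ^ ((1 + α : ℝ) : ℂ) := by
  simp only [← integral_cexp_sub_cexp ha]
  rw [← integral_integral_swap (integrable_laplace_kernel h0 h1 ha), mul_div_assoc, add_comm 1 α,
    ← integral_rpow_mul_cexp (by linarith) ha, ← integral_const_mul]
  refine setIntegral_congr_fun measurableSet_Ioi fun t ht => ?_
  have ht0 : 0 < t := ht
  have htc : (t : ℂ) ≠ 0 := by exact_mod_cast ht0.ne'
  simp only [add_comm α 1, cexp_sub_cexp_div_eq ht0]
  rw [integral_const_mul, Measure.integral_comp_mul_left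
    (fun y : ℝ => (1 - Complex.exp (-(Complex.I * y))) / ((|y| ^ (1 + α) : ℝ) : ℂ)),
    abs_of_pos (inv_pos.2 ht0), Complex.real_smul, add_comm 1 α, Real.rpow_add_one ht0.ne']
  push_cast
  field_simp

lemma integral_one_sub_cexp_mul_Gamma {α : ℝ} (h0 : 0 < α) (h1 : α < 1) :
    (∫ y : ℝ, (1 - Complex.exp (-(Complex.I * y))) / ((|y| ^ (1 + α) : ℝ) : ℂ))
        * (Real.Gamma (1 + α) : ℂ)
      = ((Real.Gamma (α / 2) * Real.Gamma (1 - α / 2) : ℝ) : ℂ) := by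
  have hone : (0 : ℝ) < (1 : ℂ).re := by simp
  have hJ := integrable_inv_sub_inv_div h0 h1 hone
  have hE := integral_inv_sub_inv_div h0 h1 hone
  rw [Complex.one_cpow, div_one (_ * _ : ℂ)] at hE
  rw [← hE]
  set f : ℝ → ℂ := fun y =>
    (1 / 1 - 1 / (1 + Complex.I * y)) / ((|y| ^ (1 + α) : ℝ) : ℂ) with hf
  have hsum : ∀ y : ℝ, f y + f (-y)
      = ((2 * (|y| ^ (1 - α) / (1 + |y| ^ 2)) : ℝ) : ℂ) := by
    intro y
    rcases eq_or_ne y 0 with rfl | hy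
    · simp [hf, Real.zero_rpow (by linarith : 1 - α ≠ 0)]
    have hy' : 0 < |y| := abs_pos.2 hy
    have hz1 : (1 : ℂ) + Complex.I * y ≠ 0 := fun h => by simpa using congrArg Complex.re h
    have hz2 : (1 : ℂ) - Complex.I * y ≠ 0 := fun h => by simpa using congrArg Complex.re h
    have hz3 : (1 : ℂ) + (y : ℂ) ^ 2 ≠ 0 := by
      have : (1 + y ^ 2 : ℝ) ≠ 0 := by positivity
      exact_mod_cast this
    have hpow : |y| ^ (1 - α) = y ^ 2 / |y| ^ (1 + α) := by
      rw [eq_div_iff (by positivity), ← Real.rpow_add hy', ← sq_abs, ← Real.rpow_two]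
      ring_nf
    have hp : ((|y| ^ (1 + α) : ℝ) : ℂ) ≠ 0 := by
      exact_mod_cast (Real.rpow_pos_of_pos hy' _).ne'
    simp only [hf, abs_neg, hpow, sq_abs]
    push_cast
    rw [mul_neg, ← sub_eq_add_neg]
    rw [show (1 : ℂ) / (1 + Complex.I * y) = (1 - Complex.I * y) / (1 + y ^ 2) by
        rw [div_eq_div_iff hz1 hz3]; ring_nf; simp,
      show (1 : ℂ) / (1 - Complex.I * y) = (1 + Complex.I * y) / (1 + y ^ 2) by
        rw [div_eq_div_iff hz2 hz3]; ring_nf; simp]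
    field_simp
    ring
  have hadd : ∫ y, (f y + f (-y)) = 2 * ∫ y, f y := by
    rw [integral_add hJ hJ.comp_neg, integral_neg_eq_self f volume, two_mul]
  simp only [hsum] at hadd
  rw [integral_complex_ofReal, integral_const_mul,
    integral_comp_abs (f := fun y => y ^ (1 - α) / (1 + y ^ 2)),
    integral_rpow_div_one_add_sq h0 h1] at hadd
  push_cast at hadd ⊢
  linear_combination (-1 / 2 : ℂ) * hadd

lemma fractionalLaplacian_constant {α : ℝ} (h0 : 0 < α) (h1 : α < 1) :
    α * 2 ^ (α - 1) * Real.Gamma ((1 + α) / 2) / (√π * Real.Gamma (1 - α / 2))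
      * (Real.Gamma (α / 2) * Real.Gamma (1 - α / 2)) = Real.Gamma (1 + α) := by
  have hd := Real.Gamma_mul_Gamma_add_half (α / 2)
  rw [show α / 2 + 1 / 2 = (1 + α) / 2 by ring, show 2 * (α / 2) = α by ring] at hd
  have hG : Real.Gamma (1 - α / 2) ≠ 0 := (Real.Gamma_pos_of_pos (by linarith)).ne'
  have hpi : √π ≠ 0 := (Real.sqrt_pos.2 Real.pi_pos).ne'
  have h2 : (2 : ℝ) ^ (α - 1) * 2 ^ (1 - α) = 1 := by
    rw [← Real.rpow_add two_pos]; simp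
  rw [add_comm 1 α, Real.Gamma_add_one h0.ne', add_comm α 1]
  rw [div_mul_eq_mul_div, div_eq_iff (mul_ne_zero hpi hG)]
  linear_combination α * Real.Gamma (1 - α / 2) * ((2 : ℝ) ^ (α - 1) * hd + Real.Gamma α * √π * h2)

/-- The exact fractional Laplacian of u(z) = (z²−1)/(z²+1) + i·2z/(z²+1)
(equation (37) of the paper). -/
theorem stmt_18 (α : ℝ) (hα : α ∈ Set.Ioo (0:ℝ) 1)
    (u : ℝ → ℂ)
    (hu : ∀ z : ℝ, u z = (((z ^ 2 - 1) / (z ^ 2 + 1) : ℝ) : ℂ)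
      + Complex.I * ((2 * z / (z ^ 2 + 1) : ℝ) : ℂ))
    (x : ℝ) :
    Integrable (fun y : ℝ => (u x - u (x + y)) / ((|y| ^ (1 + α) : ℝ) : ℂ)) ∧
    ((α * 2 ^ (α - 1) * Real.Gamma ((1 + α) / 2)
        / (Real.sqrt π * Real.Gamma (1 - α / 2)) : ℝ) : ℂ)
        * ∫ y : ℝ, (u x - u (x + y)) / ((|y| ^ (1 + α) : ℝ) : ℂ)
      = -2 * (Real.Gamma (1 + α) : ℂ) / (1 + Complex.I * (x : ℂ)) ^ ((1 + α : ℝ) : ℂ) := by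
  obtain ⟨h0, h1⟩ := hα
  have ha : 0 < (1 + Complex.I * (x : ℂ)).re := by simp
  have hux : ∀ z : ℝ, u z = 1 - 2 * (1 / (1 + Complex.I * z)) := by
    intro z
    have hz1 : (1 : ℂ) + Complex.I * z ≠ 0 := fun h => by simpa using congrArg Complex.re h
    have hz3 : (z : ℂ) ^ 2 + 1 ≠ 0 := by
      have : (z ^ 2 + 1 : ℝ) ≠ 0 := by positivity
      exact_mod_cast this
    rw [hu]
    push_cast
    rw [mul_one_div, one_sub_div hz1, mul_div_assoc', ← add_div, div_eq_div_iff hz3 hz1]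
    linear_combination (2 * (z : ℂ) ^ 2) * Complex.I_sq
  have heq : ∀ y : ℝ, (u x - u (x + y)) / ((|y| ^ (1 + α) : ℝ) : ℂ)
      = -2 * ((1 / (1 + Complex.I * x) - 1 / (1 + Complex.I * x + Complex.I * y))
        / ((|y| ^ (1 + α) : ℝ) : ℂ)) := by
    intro y
    rw [hux, hux, Complex.ofReal_add, mul_add, ← add_assoc]
    ring
  simp only [heq]
  refine ⟨(integrable_inv_sub_inv_div h0 h1 ha).const_mul _, ?_⟩
  rw [integral_const_mul, integral_inv_sub_inv_div h0 h1 ha,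
    integral_one_sub_cexp_mul_Gamma h0 h1, ← fractionalLaplacian_constant h0 h1]
  push_cast
  ring
end

section
/- Let α ∈ (0,1) ∪ (1,2), let L > 0, let s ∈ (0,π), and set x = L·cot(s). Let u : ℝ → ℂ be twice continuously differentiable with y ↦ u″(y)·|x−y|^{1−α} Lebesgue integrable on ℝ, and define v : (0,π) → ℂ by v(η) = u(L·cot(η)). Then ∫_ℝ u″(y)·|x−y|^{1−α} dy = ( sin(s)^{α−1} / L^{α} ) · ∫_0^π sin(η)^{α} · ( sin(η)·v″(η) + 2·cos(η)·v′(η) ) · |sin(s−η)|^{1−α} dη, where the right-hand integral converges absolutely. -/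
open MeasureTheory Filter Set Real intervalIntegral

theorem hasDerivAt_const_mul_cot (L : ℝ) {η : ℝ} (hη : Real.sin η ≠ 0) :
    HasDerivAt (fun t => L * Real.cot t) (-(L / Real.sin η ^ 2)) η := by
  have h := ((Real.hasDerivAt_cos η).fun_div (Real.hasDerivAt_sin η) hη).const_mul L
  simp only [← Real.cot_eq_cos_div_sin] at h
  refine h.congr_deriv ?_
  rw [← mul_div_assoc, ← neg_div]
  congr 1
  linear_combination (-L) * Real.sin_sq_add_cos_sq η

theorem cot_sub_cot {s η : ℝ} (hs : Real.sin s ≠ 0) (hη : Real.sin η ≠ 0) :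
    Real.cot s - Real.cot η = -(Real.sin (s - η) / (Real.sin s * Real.sin η)) := by
  rw [Real.cot_eq_cos_div_sin, Real.cot_eq_cos_div_sin, Real.sin_sub]
  field_simp
  ring

theorem injOn_const_mul_cot {L : ℝ} (hL : L ≠ 0) :
    InjOn (fun t => L * Real.cot t) (Ioo 0 π) := by
  intro a ha b hb hab
  have hsa := (Real.sin_pos_of_mem_Ioo ha).ne'
  have hsb := (Real.sin_pos_of_mem_Ioo hb).ne'
  have h1 : Real.cot a - Real.cot b = 0 := sub_eq_zero.2 (mul_left_cancel₀ hL hab)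
  rw [cot_sub_cot hsa hsb, neg_eq_zero, div_eq_zero_iff] at h1
  have h2 : Real.sin (a - b) = 0 := h1.resolve_right (mul_ne_zero hsa hsb)
  have h3 := (Real.sin_eq_zero_iff_of_lt_of_lt (by linarith [ha.1, hb.2])
    (by linarith [ha.2, hb.1])).1 h2
  linarith

theorem image_const_mul_cot {L : ℝ} (hL : L ≠ 0) :
    (fun t => L * Real.cot t) '' Ioo 0 π = univ := by
  refine eq_univ_of_forall fun y => ⟨π / 2 - Real.arctan (y / L), ⟨?_, ?_⟩, ?_⟩
  · linarith [Real.arctan_lt_pi_div_two (y / L)]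
  · linarith [Real.neg_pi_div_two_lt_arctan (y / L)]
  · simp only [Real.cot_eq_cos_div_sin, Real.cos_pi_div_two_sub, Real.sin_pi_div_two_sub]
    rw [← Real.tan_eq_sin_div_cos, Real.tan_arctan, mul_div_cancel₀ _ hL]

theorem hasDerivAt_comp_const_mul_cot {u : ℝ → ℂ} (hu : Differentiable ℝ u) (L : ℝ) {η : ℝ}
    (hη : Real.sin η ≠ 0) :
    HasDerivAt (fun t => u (L * Real.cot t))
      (((-(L / Real.sin η ^ 2) : ℝ) : ℂ) * deriv u (L * Real.cot η)) η := by
  have h := (hu (L * Real.cot η)).hasDerivAt.scomp η (hasDerivAt_const_mul_cot L hη)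
  rw [Complex.real_smul] at h
  exact h

theorem sin_mul_deriv_deriv_comp_cot {u : ℝ → ℂ} (hu : ContDiff ℝ 2 u) (L : ℝ) {η : ℝ}
    (hη : Real.sin η ≠ 0) :
    (Real.sin η : ℂ) * deriv (deriv fun t => u (L * Real.cot t)) η
        + 2 * (Real.cos η : ℂ) * deriv (fun t => u (L * Real.cot t)) η
      = ((L ^ 2 / Real.sin η ^ 3 : ℝ) : ℂ) * deriv (deriv u) (L * Real.cot η) := by
  have hu1 : Differentiable ℝ u := hu.differentiable (by norm_num)
  have hu2 : Differentiable ℝ (deriv u) := by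
    have h : ContDiff ℝ 1 (deriv u) := ContDiff.deriv' (n := 1) (by rwa [one_add_one_eq_two])
    exact h.differentiable (by norm_num)
  have hev : deriv (fun t => u (L * Real.cot t)) =ᶠ[nhds η]
      fun t => ((-(L / Real.sin t ^ 2) : ℝ) : ℂ) * deriv u (L * Real.cot t) := by
    filter_upwards [Real.continuous_sin.continuousAt.eventually_ne hη] with t ht
    exact (hasDerivAt_comp_const_mul_cot hu1 L ht).deriv
  have hc : HasDerivAt (fun t => -(L / Real.sin t ^ 2))
      (2 * L * Real.cos η / Real.sin η ^ 3) η := by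
    refine (((hasDerivAt_const η L).fun_div ((Real.hasDerivAt_sin η).fun_pow 2)
      (pow_ne_zero 2 hη)).fun_neg).congr_deriv ?_
    field_simp
    ring
  rw [hev.deriv_eq, hev.eq_of_nhds,
    (hc.ofReal_comp.fun_mul (hasDerivAt_comp_const_mul_cot hu2 L hη)).deriv]
  have hη' : (Real.sin η : ℂ) ≠ 0 := Complex.ofReal_ne_zero.2 hη
  push_cast at hη' ⊢
  field_simp
  ring

theorem rpow_abs_const_mul_cot_sub (α : ℝ) {L s η : ℝ} (hL : 0 < L) (hs : 0 < Real.sin s)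
    (hη : 0 < Real.sin η) :
    L / Real.sin η ^ 2 * |L * Real.cot s - L * Real.cot η| ^ (1 - α)
      = Real.sin s ^ (α - 1) / L ^ α * Real.sin η ^ α * (L ^ 2 / Real.sin η ^ 3)
        * |Real.sin (s - η)| ^ (1 - α) := by
  have h1 : |L * Real.cot s - L * Real.cot η|
      = L * |Real.sin (s - η)| / (Real.sin s * Real.sin η) := by
    rw [← mul_sub, cot_sub_cot hs.ne' hη.ne', abs_mul, abs_neg, abs_div, abs_of_pos hL,
      abs_of_pos (mul_pos hs hη), mul_div_assoc]
  have h2 : Real.sin s ^ (α - 1) = (Real.sin s ^ (1 - α))⁻¹ := by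
    rw [← Real.rpow_neg hs.le, neg_sub]
  rw [h1, h2, Real.div_rpow (by positivity) (by positivity), Real.mul_rpow hL.le (abs_nonneg _),
    Real.mul_rpow hs.le hη.le, Real.rpow_sub hL, Real.rpow_sub hη, Real.rpow_one, Real.rpow_one]
  have := Real.rpow_pos_of_pos hs (1 - α)
  have := Real.rpow_pos_of_pos hη α
  have := Real.rpow_pos_of_pos hL α
  field_simp

/-- Change-of-variables identity (equations (11)–(13) of the paper, case α ≠ 1)
mapping the second-derivative representation onto (0,π) via x = L·cot(s). -/
theorem stmt_19 (α : ℝ) (hα : α ∈ Set.Ioo (0:ℝ) 1 ∪ Set.Ioo (1:ℝ) 2)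
    (L : ℝ) (hL : 0 < L) (s : ℝ) (hs : s ∈ Set.Ioo 0 π)
    (x : ℝ) (hx : x = L * Real.cot s)
    (u : ℝ → ℂ) (hu : ContDiff ℝ 2 u)
    (hint : Integrable (fun y : ℝ => deriv (deriv u) y * ((|x - y| ^ (1 - α) : ℝ) : ℂ)))
    (v : ℝ → ℂ) (hv : ∀ η, v η = u (L * Real.cot η)) :
    IntervalIntegrable (fun η : ℝ =>
        ((Real.sin η ^ α : ℝ) : ℂ)
          * ((Real.sin η : ℂ) * deriv (deriv v) η + 2 * (Real.cos η : ℂ) * deriv v η)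
          * ((|Real.sin (s - η)| ^ (1 - α) : ℝ) : ℂ))
      MeasureTheory.volume 0 π ∧
    ∫ y : ℝ, deriv (deriv u) y * ((|x - y| ^ (1 - α) : ℝ) : ℂ)
      = ((Real.sin s ^ (α - 1) / L ^ α : ℝ) : ℂ)
          * ∫ η in (0:ℝ)..π,
              ((Real.sin η ^ α : ℝ) : ℂ)
                * ((Real.sin η : ℂ) * deriv (deriv v) η + 2 * (Real.cos η : ℂ) * deriv v η)
                * ((|Real.sin (s - η)| ^ (1 - α) : ℝ) : ℂ) := by
  obtain rfl : v = fun t => u (L * Real.cot t) := funext hv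
  subst hx
  set g : ℝ → ℂ := fun y =>
    deriv (deriv u) y * ((|L * Real.cot s - y| ^ (1 - α) : ℝ) : ℂ) with hg
  set h : ℝ → ℂ := fun η =>
    ((Real.sin η ^ α : ℝ) : ℂ)
      * ((Real.sin η : ℂ) * deriv (deriv fun t => u (L * Real.cot t)) η
        + 2 * (Real.cos η : ℂ) * deriv (fun t => u (L * Real.cot t)) η)
      * ((|Real.sin (s - η)| ^ (1 - α) : ℝ) : ℂ) with hh
  set C : ℝ := Real.sin s ^ (α - 1) / L ^ α
  have hsin := Real.sin_pos_of_mem_Ioo hs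
  have hC : (C : ℂ) ≠ 0 :=
    Complex.ofReal_ne_zero.2
      (div_pos (Real.rpow_pos_of_pos hsin _) (Real.rpow_pos_of_pos hL _)).ne'
  have hder : ∀ η ∈ Ioo 0 π, HasDerivWithinAt (fun t => L * Real.cot t)
      (-(L / Real.sin η ^ 2)) (Ioo 0 π) η := fun η hη =>
    (hasDerivAt_const_mul_cot L (Real.sin_pos_of_mem_Ioo hη).ne').hasDerivWithinAt
  have hpt : EqOn (fun η => |-(L / Real.sin η ^ 2)| • g (L * Real.cot η))
      (fun η => (C : ℂ) * h η) (Ioo 0 π) := by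
    intro η hη
    have hη0 := Real.sin_pos_of_mem_Ioo hη
    have key := congrArg (fun r : ℝ => (r : ℂ)) (rpow_abs_const_mul_cot_sub α hL hsin hη0)
    simp only [hg, hh]
    rw [sin_mul_deriv_deriv_comp_cot hu L hη0.ne', abs_neg,
      abs_of_pos (div_pos hL (pow_pos hη0 2)), Complex.real_smul]
    rw [Complex.ofReal_mul, Complex.ofReal_mul, Complex.ofReal_mul, Complex.ofReal_mul] at key
    linear_combination deriv (deriv u) (L * Real.cot η) * key
  constructor
  · rw [intervalIntegrable_iff_integrableOn_Ioo_of_le Real.pi_pos.le]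
    have h1 : IntegrableOn g ((fun t => L * Real.cot t) '' Ioo 0 π) := hint.integrableOn
    rw [integrableOn_image_iff_integrableOn_abs_deriv_smul measurableSet_Ioo hder
      (injOn_const_mul_cot hL.ne'), integrableOn_congr_fun hpt measurableSet_Ioo] at h1
    exact (integrable_const_mul_iff (isUnit_iff_ne_zero.2 hC) h).1 h1
  · rw [integral_of_le Real.pi_pos.le, integral_Ioc_eq_integral_Ioo,
      ← MeasureTheory.integral_const_mul, ← setIntegral_congr_fun measurableSet_Ioo hpt,
      ← integral_image_eq_integral_abs_deriv_smul measurableSet_Ioo hder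
        (injOn_const_mul_cot hL.ne'), image_const_mul_cot hL.ne', setIntegral_univ]
end
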